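/- Let V : (0,2] → ℝ be defined by V(r) = (1+t)⁵ + (t+1)²(t−1/3)²(t+1/3)²(t²−5/9)² / (6(1−t)²), where t = 1 − r²/2. Then the regular dodecahedron is the unique global minimizer of E_V among 20-point configurations on the unit sphere S² ⊂ ℝ³: for every 20-point configuration C on S², E_V(C) ≥ E_V(dodecahedron), and equality holds only if C is the image of the regular dodecahedron configuration under an orthogonal transformation of ℝ³. -/

import Mathlib

open scoped Classical

/-- The `V`-potential energy of a finite configuration `C`:
`E_V(C) = (1/2) ∑_{x,y ∈ C, x ≠ y} V(|x-y|)`. -/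
noncomputable def energy {n : ℕ} (V : ℝ → ℝ) (C : Finset (EuclideanSpace ℝ (Fin n))) : ℝ :=
  (1 / 2) * ∑ x ∈ C, ∑ y ∈ C, if x = y then 0 else V (dist x y)

/-- The distance distribution of a finite configuration: `d_C(r)` is the number of
unordered pairs of distinct points of `C` at Euclidean distance `r`. -/
noncomputable def distDistrib {n : ℕ} (C : Finset (EuclideanSpace ℝ (Fin n))) : ℝ → ℝ :=
  fun r => ((C ×ˢ C).filter fun p => p.1 ≠ p.2 ∧ dist p.1 p.2 = r).card / 2

/-- `C` lies on the unit sphere `S^{n-1}`. -/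
def onSphere {n : ℕ} (C : Finset (EuclideanSpace ℝ (Fin n))) : Prop :=
  ∀ x ∈ C, ‖x‖ = 1

/-- `C'` is the image of `C` under an orthogonal transformation of `ℝ^n`. -/
def isOrthImage {n : ℕ} (C C' : Finset (EuclideanSpace ℝ (Fin n))) : Prop :=
  ∃ O : EuclideanSpace ℝ (Fin n) ≃ₗᵢ[ℝ] EuclideanSpace ℝ (Fin n), C' = C.image O

/-- The golden ratio. -/
noncomputable def phi : ℝ := (1 + Real.sqrt 5) / 2

/-- The regular dodecahedron configuration: the 8 points `(±1, ±1, ±1)/√3` together with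
the 12 cyclic permutations of the coordinates of `(0, ±1/φ, ±φ)/√3`. -/
noncomputable def dodecConfig : Finset (EuclideanSpace ℝ (Fin 3)) :=
  (Finset.image (fun s : Fin 3 → Bool =>
      (Real.sqrt 3)⁻¹ • (WithLp.equiv 2 (Fin 3 → ℝ)).symm
        (fun i => if s i then 1 else -1)) Finset.univ) ∪
  (Finset.image (fun s : Bool × Bool =>
      (Real.sqrt 3)⁻¹ • (WithLp.equiv 2 (Fin 3 → ℝ)).symm
        ![0, (if s.1 then 1 else -1) * phi⁻¹, (if s.2 then 1 else -1) * phi]) Finset.univ) ∪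
  (Finset.image (fun s : Bool × Bool =>
      (Real.sqrt 3)⁻¹ • (WithLp.equiv 2 (Fin 3 → ℝ)).symm
        ![(if s.2 then 1 else -1) * phi, 0, (if s.1 then 1 else -1) * phi⁻¹]) Finset.univ) ∪
  (Finset.image (fun s : Bool × Bool =>
      (Real.sqrt 3)⁻¹ • (WithLp.equiv 2 (Fin 3 → ℝ)).symm
        ![(if s.1 then 1 else -1) * phi⁻¹, (if s.2 then 1 else -1) * phi, 0]) Finset.univ)

/-- The potential of Theorem 3 (the dodecahedron theorem), as a function of the inner
product `t = 1 - r²/2`. -/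
noncomputable def dodecW : ℝ → ℝ := fun t =>
  (1 + t) ^ 5 +
    (t + 1) ^ 2 * (t - 1 / 3) ^ 2 * (t + 1 / 3) ^ 2 * (t ^ 2 - 5 / 9) ^ 2 /
      (6 * (1 - t) ^ 2)

/-- The potential of Theorem 3 (the dodecahedron theorem). -/
noncomputable def dodecV : ℝ → ℝ := fun r => dodecW (1 - r ^ 2 / 2)

/-- The ring `ℤ[φ]`. -/
abbrev GoldenInt : Type := QuadraticAlgebra ℤ 1 1

theorem phi_sq : phi ^ 2 = phi + 1 := Real.goldenRatio_sq

theorem phi_inv : phi⁻¹ = phi - 1 := by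
  have h : phi ≠ 0 := Real.goldenRatio_ne_zero
  field_simp
  linear_combination -phi_sq

theorem sqrt_five_eq : Real.sqrt 5 = 2 * phi - 1 := by
  unfold phi
  ring

/-- The embedding of `ℤ[φ]` into the real numbers. -/
noncomputable def goldenEval : GoldenInt →+* ℝ :=
  (QuadraticAlgebra.lift (R := ℤ) (a := 1) (b := 1)
    ⟨phi, by rw [← sq, phi_sq, one_smul, one_smul, add_comm]⟩).toRingHom

theorem goldenEval_apply (z : GoldenInt) : goldenEval z = z.re + z.im * phi := by
  simp [goldenEval, QuadraticAlgebra.lift]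

theorem goldenEval_phi : goldenEval ⟨0, 1⟩ = phi := by
  simp [goldenEval_apply]

theorem goldenEval_phi_inv : goldenEval ⟨-1, 1⟩ = phi⁻¹ := by
  rw [goldenEval_apply, phi_inv]
  push_cast
  ring

theorem goldenEval_injective : Function.Injective goldenEval := by
  rw [injective_iff_map_eq_zero]
  intro z hz
  rw [goldenEval_apply] at hz
  have him : z.im = 0 := by
    by_contra h
    have hirr : Irrational phi := Real.goldenRatio_irrational
    refine ((hirr.intCast_mul h).intCast_add z.re).ne_zero hz
  have hre : z.re = 0 := by
    simpa [him] using hz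
  exact QuadraticAlgebra.ext hre him

/-- Labels for the vertices of the dodecahedron: eight cube vertices, and three groups of four. -/
abbrev DodecIndex : Type := (Bool × Bool × Bool) ⊕ (Fin 3 × Bool × Bool)

/-- The sign encoded by a Boolean. -/
def boolSign (b : Bool) : GoldenInt := if b then 1 else -1

/-- The coordinates of the dodecahedron vertices, multiplied by `√3`. -/
def dodecCoord : DodecIndex → Fin 3 → GoldenInt
  | .inl (a, b, c) => ![boolSign a, boolSign b, boolSign c]
  | .inr (0, a, b) => ![0, boolSign a * ⟨-1, 1⟩, boolSign b * ⟨0, 1⟩]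
  | .inr (1, a, b) => ![boolSign b * ⟨0, 1⟩, 0, boolSign a * ⟨-1, 1⟩]
  | .inr (2, a, b) => ![boolSign a * ⟨-1, 1⟩, boolSign b * ⟨0, 1⟩, 0]

/-- The dot product on `ℤ[φ]³`. -/
def goldenDot (u v : Fin 3 → GoldenInt) : GoldenInt := u 0 * v 0 + u 1 * v 1 + u 2 * v 2

/-- The possible inner products of distinct dodecahedron vertices, multiplied by `3`. -/
def dodecInner : Fin 5 → GoldenInt := ![-3, 1, -1, ⟨-1, 2⟩, ⟨1, -2⟩]

theorem goldenDot_dodecCoord_self (i : DodecIndex) :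
    goldenDot (dodecCoord i) (dodecCoord i) = 3 := by
  revert i
  decide +kernel

theorem goldenDot_dodecCoord (i j : DodecIndex) (h : i ≠ j) :
    ∃ k, goldenDot (dodecCoord i) (dodecCoord j) = dodecInner k := by
  revert i j
  decide +kernel

/-- A vertex of the dodecahedron is determined by its inner products with the three neighbours of
`(1, 1, 1) / √3`, and every admissible triple of inner products arises from a vertex. -/
theorem exists_dodecCoord_of_inner (k : Fin 4 → Option (Fin 5)) :
    let v : Fin 4 → GoldenInt := fun i => (k i).elim 3 dodecInner
    v 0 + v 1 + v 2 = ⟨-1, 2⟩ * v 3 →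
    v 0 * v 0 + v 1 * v 1 + v 2 * v 2 = 6 + v 3 * v 3 →
    ∃ i : DodecIndex, ∀ m : Fin 3,
      goldenDot (dodecCoord i) (dodecCoord (.inr (m, true, true))) = v m.castSucc := by
  revert k
  decide +kernel

theorem goldenEval_boolSign (b : Bool) : goldenEval (boolSign b) = if b then 1 else -1 := by
  cases b <;> simp [boolSign]

/-- The vertices of the dodecahedron. -/
noncomputable def dodecVertex (i : DodecIndex) : EuclideanSpace ℝ (Fin 3) :=
  (Real.sqrt 3)⁻¹ • WithLp.toLp 2 (fun j => goldenEval (dodecCoord i j))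

theorem inner_fin_three (x y : EuclideanSpace ℝ (Fin 3)) :
    inner ℝ x y = x 0 * y 0 + x 1 * y 1 + x 2 * y 2 := by
  simp [PiLp.inner_apply, Fin.sum_univ_three, mul_comm]

theorem inv_sqrt_three_sq : (Real.sqrt 3)⁻¹ ^ 2 = (1 / 3 : ℝ) := by
  rw [inv_pow, Real.sq_sqrt (by norm_num)]
  norm_num

theorem inner_dodecVertex (i j : DodecIndex) :
    inner ℝ (dodecVertex i) (dodecVertex j)
      = goldenEval (goldenDot (dodecCoord i) (dodecCoord j)) / 3 := by
  simp only [inner_fin_three, dodecVertex, goldenDot, map_add, map_mul, PiLp.smul_apply,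
    smul_eq_mul]
  linear_combination (goldenEval (dodecCoord i 0) * goldenEval (dodecCoord j 0)
    + goldenEval (dodecCoord i 1) * goldenEval (dodecCoord j 1)
    + goldenEval (dodecCoord i 2) * goldenEval (dodecCoord j 2)) * inv_sqrt_three_sq

theorem norm_dodecVertex (i : DodecIndex) : ‖dodecVertex i‖ = 1 := by
  have h : ‖dodecVertex i‖ ^ 2 = 1 := by
    rw [← real_inner_self_eq_norm_sq, inner_dodecVertex, goldenDot_dodecCoord_self, map_ofNat]
    norm_num
  exact (pow_eq_one_iff_of_nonneg (norm_nonneg _) two_ne_zero).mp h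

/-- The inner products at which `dodecW` touches `(1 + t) ^ 5`. -/
def IsDodecInner (t : ℝ) : Prop :=
  t = -1 ∨ t = 1 / 3 ∨ t = -1 / 3 ∨ t = Real.sqrt 5 / 3 ∨ t = -Real.sqrt 5 / 3

theorem isDodecInner_iff (t : ℝ) :
    IsDodecInner t ↔ ∃ k, t = goldenEval (dodecInner k) / 3 := by
  have h0 : goldenEval (dodecInner 0) = -3 := by
    simp only [dodecInner, Matrix.cons_val_zero, map_neg, map_ofNat]
  have h1 : goldenEval (dodecInner 1) = 1 := by simp [dodecInner]
  have h2 : goldenEval (dodecInner 2) = -1 := by simp [dodecInner]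
  have h3 : goldenEval (dodecInner 3) = 2 * phi - 1 := by
    simp [dodecInner, goldenEval_apply]
    ring
  have h4 : goldenEval (dodecInner 4) = -(2 * phi - 1) := by
    simp [dodecInner, goldenEval_apply]
    ring
  have h : (-3 : ℝ) / 3 = -1 := by norm_num
  constructor
  · rintro (ht | ht | ht | ht | ht)
    exacts [⟨0, by rw [h0, ht, h]⟩, ⟨1, by rw [h1, ht]⟩, ⟨2, by rw [h2, ht]⟩,
      ⟨3, by rw [h3, ht, sqrt_five_eq]⟩, ⟨4, by rw [h4, ht, sqrt_five_eq]⟩]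
  · rintro ⟨k, hk⟩
    unfold IsDodecInner
    rw [sqrt_five_eq]
    fin_cases k
    · exact .inl (hk.trans (by rw [← h, ← h0]; rfl))
    · exact .inr (.inl (hk.trans (by rw [← h1]; rfl)))
    · exact .inr (.inr (.inl (hk.trans (by rw [← h2]; rfl))))
    · exact .inr (.inr (.inr (.inl (hk.trans (by rw [← h3]; rfl)))))
    · exact .inr (.inr (.inr (.inr (hk.trans (by rw [← h4]; rfl)))))

theorem inner_dodecVertex_of_ne (i j : DodecIndex) (h : i ≠ j) :
    IsDodecInner (inner ℝ (dodecVertex i) (dodecVertex j)) := by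
  obtain ⟨k, hk⟩ := goldenDot_dodecCoord i j h
  exact (isDodecInner_iff _).mpr ⟨k, by rw [inner_dodecVertex, hk]⟩

theorem IsDodecInner.lt_one {t : ℝ} (h : IsDodecInner t) : t < 1 := by
  have h5 : Real.sqrt 5 < 3 := by
    rw [Real.sqrt_lt' (by norm_num)]
    norm_num
  have := Real.sqrt_nonneg 5
  rcases h with rfl | rfl | rfl | rfl | rfl <;> linarith

theorem dodecVertex_injective : Function.Injective dodecVertex := by
  intro i j hij
  by_contra h
  have h1 := (inner_dodecVertex_of_ne i j h).lt_one
  rw [hij, real_inner_self_eq_norm_sq, norm_dodecVertex] at h1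
  norm_num at h1

theorem dodecConfig_eq_image : dodecConfig = Finset.univ.image dodecVertex := by
  ext x
  simp only [dodecConfig, Finset.mem_union, Finset.mem_image, Finset.mem_univ, true_and,
    Sum.exists, or_assoc]
  refine or_congr ⟨?_, ?_⟩ ⟨?_, ?_⟩
  · rintro ⟨s, rfl⟩
    refine ⟨(s 0, s 1, s 2), ?_⟩
    ext j
    fin_cases j <;> simp [dodecVertex, dodecCoord, goldenEval_boolSign]
  · rintro ⟨⟨a, b, c⟩, rfl⟩
    refine ⟨![a, b, c], ?_⟩
    ext j
    fin_cases j
    · cases a <;> simp [dodecVertex, dodecCoord, goldenEval_boolSign]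
    · cases b <;> simp [dodecVertex, dodecCoord, goldenEval_boolSign]
    · cases c <;> simp [dodecVertex, dodecCoord, goldenEval_boolSign]
  · rintro (⟨s, rfl⟩ | ⟨s, rfl⟩ | ⟨s, rfl⟩)
    · refine ⟨(0, s), ?_⟩
      ext j
      fin_cases j <;> simp [dodecVertex, dodecCoord, goldenEval_boolSign, goldenEval_phi,
        goldenEval_phi_inv]
    · refine ⟨(1, s), ?_⟩
      ext j
      fin_cases j <;> simp [dodecVertex, dodecCoord, goldenEval_boolSign, goldenEval_phi,
        goldenEval_phi_inv]
    · refine ⟨(2, s), ?_⟩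
      ext j
      fin_cases j <;> simp [dodecVertex, dodecCoord, goldenEval_boolSign, goldenEval_phi,
        goldenEval_phi_inv]
  · rintro ⟨⟨k, s⟩, rfl⟩
    fin_cases k
    · refine .inl ⟨s, ?_⟩
      ext j
      fin_cases j <;> simp [dodecVertex, dodecCoord, goldenEval_boolSign, goldenEval_phi,
        goldenEval_phi_inv]
    · refine .inr (.inl ⟨s, ?_⟩)
      ext j
      fin_cases j <;> simp [dodecVertex, dodecCoord, goldenEval_boolSign, goldenEval_phi,
        goldenEval_phi_inv]
    · refine .inr (.inr ⟨s, ?_⟩)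
      ext j
      fin_cases j <;> simp [dodecVertex, dodecCoord, goldenEval_boolSign, goldenEval_phi,
        goldenEval_phi_inv]

theorem sum_dodecConfig (f : EuclideanSpace ℝ (Fin 3) → ℝ) :
    ∑ x ∈ dodecConfig, f x = ∑ i, f (dodecVertex i) := by
  rw [dodecConfig_eq_image, Finset.sum_image fun i _ j _ h => dodecVertex_injective h]

theorem phi_mul_inv : phi * phi⁻¹ = 1 := mul_inv_cancel₀ Real.goldenRatio_ne_zero

theorem phi_sq_add_inv_sq : phi ^ 2 + phi⁻¹ ^ 2 = 3 := by
  rw [phi_inv]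
  linear_combination 2 * phi_sq

theorem phi_pow_four_add_inv_pow_four : phi ^ 4 + phi⁻¹ ^ 4 = 7 := by
  linear_combination (phi ^ 2 + phi⁻¹ ^ 2 + 3) * phi_sq_add_inv_sq
    - 2 * (phi * phi⁻¹ + 1) * phi_mul_inv

theorem inner_dodecVertex_inl (a b c : Bool) (x : EuclideanSpace ℝ (Fin 3)) :
    inner ℝ (dodecVertex (.inl (a, b, c))) x = (Real.sqrt 3)⁻¹ *
      ((if a then 1 else -1) * x 0 + (if b then 1 else -1) * x 1
        + (if c then 1 else -1) * x 2) := by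
  simp only [inner_fin_three, dodecVertex, dodecCoord, PiLp.smul_apply, smul_eq_mul]
  simp [goldenEval_boolSign, -mul_ite, -ite_mul]
  ring

theorem inner_dodecVertex_inr_zero (a b : Bool) (x : EuclideanSpace ℝ (Fin 3)) :
    inner ℝ (dodecVertex (.inr (0, a, b))) x = (Real.sqrt 3)⁻¹ *
      ((if a then 1 else -1) * phi⁻¹ * x 1 + (if b then 1 else -1) * phi * x 2) := by
  simp only [inner_fin_three, dodecVertex, dodecCoord, PiLp.smul_apply, smul_eq_mul]
  simp [goldenEval_boolSign, goldenEval_phi, goldenEval_phi_inv, -mul_ite, -ite_mul]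
  ring

theorem inner_dodecVertex_inr_one (a b : Bool) (x : EuclideanSpace ℝ (Fin 3)) :
    inner ℝ (dodecVertex (.inr (1, a, b))) x = (Real.sqrt 3)⁻¹ *
      ((if a then 1 else -1) * phi⁻¹ * x 2 + (if b then 1 else -1) * phi * x 0) := by
  simp only [inner_fin_three, dodecVertex, dodecCoord, PiLp.smul_apply, smul_eq_mul]
  simp [goldenEval_boolSign, goldenEval_phi, goldenEval_phi_inv, -mul_ite, -ite_mul]
  ring

theorem inner_dodecVertex_inr_two (a b : Bool) (x : EuclideanSpace ℝ (Fin 3)) :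
    inner ℝ (dodecVertex (.inr (2, a, b))) x = (Real.sqrt 3)⁻¹ *
      ((if a then 1 else -1) * phi⁻¹ * x 0 + (if b then 1 else -1) * phi * x 1) := by
  simp only [inner_fin_three, dodecVertex, dodecCoord, PiLp.smul_apply, smul_eq_mul]
  simp [goldenEval_boolSign, goldenEval_phi, goldenEval_phi_inv, -mul_ite, -ite_mul]
  ring

/-- Summation over the dodecahedron, grouped into antipodal pairs, for functions of the inner
products with two given vectors. -/
theorem sum_dodecConfig_inner (f : ℝ → ℝ → ℝ) (x v : EuclideanSpace ℝ (Fin 3)) :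
    let g : ℝ → ℝ → ℝ := fun t u =>
      f ((Real.sqrt 3)⁻¹ * t) ((Real.sqrt 3)⁻¹ * u)
        + f (-((Real.sqrt 3)⁻¹ * t)) (-((Real.sqrt 3)⁻¹ * u))
    ∑ z ∈ dodecConfig, f (inner ℝ z x) (inner ℝ z v) =
      g (x 0 + x 1 + x 2) (v 0 + v 1 + v 2) + g (x 0 + x 1 - x 2) (v 0 + v 1 - v 2)
      + g (x 0 - x 1 + x 2) (v 0 - v 1 + v 2) + g (x 0 - x 1 - x 2) (v 0 - v 1 - v 2)
      + g (phi⁻¹ * x 1 + phi * x 2) (phi⁻¹ * v 1 + phi * v 2)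
      + g (phi⁻¹ * x 1 - phi * x 2) (phi⁻¹ * v 1 - phi * v 2)
      + g (phi⁻¹ * x 2 + phi * x 0) (phi⁻¹ * v 2 + phi * v 0)
      + g (phi⁻¹ * x 2 - phi * x 0) (phi⁻¹ * v 2 - phi * v 0)
      + g (phi⁻¹ * x 0 + phi * x 1) (phi⁻¹ * v 0 + phi * v 1)
      + g (phi⁻¹ * x 0 - phi * x 1) (phi⁻¹ * v 0 - phi * v 1) := by
  rw [sum_dodecConfig fun z => f (inner ℝ z x) (inner ℝ z v)]
  simp only [Fintype.sum_sum_type, Fintype.sum_prod_type, Fintype.sum_bool, Fin.sum_univ_three,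
    inner_dodecVertex_inl, inner_dodecVertex_inr_zero, inner_dodecVertex_inr_one,
    inner_dodecVertex_inr_two, if_true, Bool.false_eq_true, if_false]
  ring_nf

theorem sum_dodecConfig_pow_zero (v : EuclideanSpace ℝ (Fin 3)) :
    ∑ z ∈ dodecConfig, inner ℝ z v = 0 := by
  rw [sum_dodecConfig_inner (fun _ u => u) v v]
  ring

theorem sum_dodecConfig_pow_one (x v : EuclideanSpace ℝ (Fin 3)) :
    ∑ z ∈ dodecConfig, inner ℝ z x * inner ℝ z v = 20 / 3 * inner ℝ x v := by
  rw [sum_dodecConfig_inner (fun t u => t * u) x v, inner_fin_three]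
  linear_combination 20 * (x 0 * v 0 + x 1 * v 1 + x 2 * v 2) * inv_sqrt_three_sq
    + 4 * (Real.sqrt 3)⁻¹ ^ 2 * (x 0 * v 0 + x 1 * v 1 + x 2 * v 2) * phi_sq_add_inv_sq

theorem sum_dodecConfig_pow_two (x v : EuclideanSpace ℝ (Fin 3)) :
    ∑ z ∈ dodecConfig, (inner ℝ z x) ^ 2 * inner ℝ z v = 0 := by
  rw [sum_dodecConfig_inner (fun t u => t ^ 2 * u) x v]
  ring

theorem sum_dodecConfig_pow_three (x v : EuclideanSpace ℝ (Fin 3)) :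
    ∑ z ∈ dodecConfig, (inner ℝ z x) ^ 3 * inner ℝ z v = 4 * ‖x‖ ^ 2 * inner ℝ x v := by
  rw [sum_dodecConfig_inner (fun t u => t ^ 3 * u) x v, ← real_inner_self_eq_norm_sq,
    inner_fin_three, inner_fin_three]
  linear_combination 36 * (x 0 * x 0 + x 1 * x 1 + x 2 * x 2)
      * (x 0 * v 0 + x 1 * v 1 + x 2 * v 2)
      * ((Real.sqrt 3)⁻¹ ^ 2 + 1 / 3) * inv_sqrt_three_sq
    + 4 * (Real.sqrt 3)⁻¹ ^ 4 * (x 0 ^ 3 * v 0 + x 1 ^ 3 * v 1 + x 2 ^ 3 * v 2)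
      * phi_pow_four_add_inv_pow_four
    + 12 * (Real.sqrt 3)⁻¹ ^ 4 * (x 0 * v 0 * (x 1 ^ 2 + x 2 ^ 2)
      + x 1 * v 1 * (x 0 ^ 2 + x 2 ^ 2) + x 2 * v 2 * (x 0 ^ 2 + x 1 ^ 2))
      * (phi * phi⁻¹ + 1) * phi_mul_inv

theorem sum_dodecConfig_pow_four (x v : EuclideanSpace ℝ (Fin 3)) :
    ∑ z ∈ dodecConfig, (inner ℝ z x) ^ 4 * inner ℝ z v = 0 := by
  rw [sum_dodecConfig_inner (fun t u => t ^ 4 * u) x v]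
  ring
/-- The coordinates of the fifth tensor power of `(1, u)`. -/
noncomputable def tensorCoord (u : EuclideanSpace ℝ (Fin 3)) (w : Fin 5 → Fin 4) : ℝ :=
  ∏ k, (Fin.cons 1 u.ofLp : Fin 4 → ℝ) (w k)

theorem prod_add_inner_eq_sum (α : Fin 5 → ℝ) (y : Fin 5 → EuclideanSpace ℝ (Fin 3))
    (u : EuclideanSpace ℝ (Fin 3)) :
    ∏ k, (α k + inner ℝ u (y k)) =
      ∑ w : Fin 5 → Fin 4,
        tensorCoord u w * ∏ k, (Fin.cons (α k) (y k).ofLp : Fin 4 → ℝ) (w k) := by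
  have h : ∀ k, α k + inner ℝ u (y k) = ∑ j : Fin 4,
      (Fin.cons 1 u.ofLp : Fin 4 → ℝ) j * (Fin.cons (α k) (y k).ofLp : Fin 4 → ℝ) j := by
    intro k
    rw [Fin.sum_univ_succ, inner_fin_three, Fin.sum_univ_three]
    simp only [Fin.cons_zero, Fin.cons_succ, one_mul]
  simp only [h, Finset.prod_univ_sum, Fintype.piFinset_univ, tensorCoord,
    Finset.prod_mul_distrib]

theorem one_add_inner_pow_five (u v : EuclideanSpace ℝ (Fin 3)) :
    (1 + inner ℝ u v) ^ 5 = ∑ w, tensorCoord u w * tensorCoord v w := by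
  have h := prod_add_inner_eq_sum (fun _ => 1) (fun _ => v) u
  simpa only [Finset.prod_const, Finset.card_univ, Fintype.card_fin, tensorCoord] using h

theorem sum_sum_one_add_inner_pow_five (A B : Finset (EuclideanSpace ℝ (Fin 3))) :
    ∑ x ∈ A, ∑ y ∈ B, (1 + inner ℝ x y) ^ 5
      = ∑ w, (∑ x ∈ A, tensorCoord x w) * ∑ y ∈ B, tensorCoord y w := by
  simp only [one_add_inner_pow_five, Finset.sum_mul_sum]
  rw [Finset.sum_comm (s := Finset.univ)]
  exact Finset.sum_congr rfl fun x _ => Finset.sum_comm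

theorem card_dodecConfig : dodecConfig.card = 20 := by
  rw [dodecConfig_eq_image, Finset.card_image_of_injective _ dodecVertex_injective]
  rfl

theorem onSphere_dodecConfig : onSphere dodecConfig := by
  intro x hx
  rw [dodecConfig_eq_image] at hx
  obtain ⟨i, -, rfl⟩ := Finset.mem_image.mp hx
  exact norm_dodecVertex i

theorem sum_dodecConfig_one_add_inner_pow_five (x : EuclideanSpace ℝ (Fin 3)) (hx : ‖x‖ = 1) :
    ∑ z ∈ dodecConfig, (1 + inner ℝ x z) ^ 5 = 320 / 3 := by
  have h : ∀ z : EuclideanSpace ℝ (Fin 3), (1 + inner ℝ x z) ^ 5 =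
      1 + 5 * inner ℝ z x + 10 * (inner ℝ z x * inner ℝ z x)
        + 10 * ((inner ℝ z x) ^ 2 * inner ℝ z x) + 5 * ((inner ℝ z x) ^ 3 * inner ℝ z x)
        + (inner ℝ z x) ^ 4 * inner ℝ z x := by
    intro z
    rw [real_inner_comm]
    ring
  simp only [h, Finset.sum_add_distrib, ← Finset.mul_sum, sum_dodecConfig_pow_zero,
    sum_dodecConfig_pow_one, sum_dodecConfig_pow_two, sum_dodecConfig_pow_three,
    sum_dodecConfig_pow_four, real_inner_self_eq_norm_sq, hx, Finset.sum_const, card_dodecConfig]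
  norm_num

/-- The distance between the fifth-order moments of a configuration and of the dodecahedron. -/
noncomputable def momentGap (C : Finset (EuclideanSpace ℝ (Fin 3))) : ℝ :=
  ∑ w, (∑ x ∈ C, tensorCoord x w - ∑ x ∈ dodecConfig, tensorCoord x w) ^ 2

theorem sum_sum_eq_momentGap_add (C : Finset (EuclideanSpace ℝ (Fin 3))) (hC : C.card = 20)
    (hs : onSphere C) :
    ∑ x ∈ C, ∑ y ∈ C, (1 + inner ℝ x y) ^ 5 = momentGap C + 6400 / 3 := by
  have h : ∀ A : Finset (EuclideanSpace ℝ (Fin 3)), A.card = 20 → onSphere A →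
      ∑ w, (∑ x ∈ A, tensorCoord x w) * ∑ y ∈ dodecConfig, tensorCoord y w = 6400 / 3 := by
    intro A hA hAs
    rw [← sum_sum_one_add_inner_pow_five,
      Finset.sum_congr rfl fun x hx => sum_dodecConfig_one_add_inner_pow_five x (hAs x hx),
      Finset.sum_const, hA]
    norm_num
  have h1 := h C hC hs
  have h2 := h dodecConfig card_dodecConfig onSphere_dodecConfig
  have h3 : momentGap C = ∑ w, (∑ x ∈ C, tensorCoord x w) * ∑ y ∈ C, tensorCoord y w
      - 2 * ∑ w, (∑ x ∈ C, tensorCoord x w) * ∑ y ∈ dodecConfig, tensorCoord y w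
      + ∑ w, (∑ x ∈ dodecConfig, tensorCoord x w) * ∑ y ∈ dodecConfig, tensorCoord y w := by
    rw [momentGap, Finset.mul_sum, ← Finset.sum_sub_distrib, ← Finset.sum_add_distrib]
    exact Finset.sum_congr rfl fun w _ => by ring
  rw [sum_sum_one_add_inner_pow_five]
  linarith

theorem momentGap_nonneg (C : Finset (EuclideanSpace ℝ (Fin 3))) : 0 ≤ momentGap C :=
  Finset.sum_nonneg fun _ _ => sq_nonneg _

theorem momentGap_dodecConfig : momentGap dodecConfig = 0 := by
  simp [momentGap]

/-- The excess of `dodecW` over `(1 + t) ^ 5`. -/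
noncomputable def dodecExcess (t : ℝ) : ℝ :=
  (t + 1) ^ 2 * (t - 1 / 3) ^ 2 * (t + 1 / 3) ^ 2 * (t ^ 2 - 5 / 9) ^ 2 / (6 * (1 - t) ^ 2)

theorem dodecExcess_nonneg (t : ℝ) : 0 ≤ dodecExcess t := by
  unfold dodecExcess
  positivity

theorem dodecExcess_eq_zero_iff {t : ℝ} (ht : t ≠ 1) : dodecExcess t = 0 ↔ IsDodecInner t := by
  have h1 : 1 - t ≠ 0 := sub_ne_zero.mpr ht.symm
  have h5 : t ^ 2 - 5 / 9 = (t - Real.sqrt 5 / 3) * (t + Real.sqrt 5 / 3) := by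
    linear_combination (1 / 9 : ℝ) * Real.sq_sqrt (show (0 : ℝ) ≤ 5 by norm_num)
  unfold dodecExcess IsDodecInner
  rw [h5]
  simp only [div_eq_zero_iff, mul_eq_zero, pow_eq_zero_iff, ne_eq, OfNat.ofNat_ne_zero,
    not_false_eq_true, h1, or_false, or_assoc, sub_eq_zero, add_eq_zero_iff_eq_neg, neg_div]

/-- The sum over ordered pairs of distinct points of the excess of `dodecW` over `(1 + t) ^ 5`. -/
noncomputable def excessSum (C : Finset (EuclideanSpace ℝ (Fin 3))) : ℝ :=
  ∑ x ∈ C, ∑ y ∈ C, if x = y then 0 else dodecExcess (inner ℝ x y)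

theorem excessSum_term_nonneg (x y : EuclideanSpace ℝ (Fin 3)) :
    0 ≤ if x = y then 0 else dodecExcess (inner ℝ x y) := by
  split_ifs
  exacts [le_rfl, dodecExcess_nonneg _]

theorem excessSum_nonneg (C : Finset (EuclideanSpace ℝ (Fin 3))) : 0 ≤ excessSum C :=
  Finset.sum_nonneg fun _ _ => Finset.sum_nonneg fun _ _ => excessSum_term_nonneg _ _

theorem inner_ne_one_of_ne {x y : EuclideanSpace ℝ (Fin 3)} (hx : ‖x‖ = 1) (hy : ‖y‖ = 1)
    (hxy : x ≠ y) : inner ℝ x y ≠ 1 :=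
  fun h => hxy ((inner_eq_one_iff_of_norm_eq_one hx hy).mp h)

theorem excessSum_eq_zero_iff (C : Finset (EuclideanSpace ℝ (Fin 3))) (hs : onSphere C) :
    excessSum C = 0 ↔ ∀ x ∈ C, ∀ y ∈ C, x ≠ y → IsDodecInner (inner ℝ x y) := by
  unfold excessSum
  rw [Finset.sum_eq_zero_iff_of_nonneg
    fun _ _ => Finset.sum_nonneg fun _ _ => excessSum_term_nonneg _ _]
  refine forall₂_congr fun x hx => ?_
  rw [Finset.sum_eq_zero_iff_of_nonneg fun _ _ => excessSum_term_nonneg _ _]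
  refine forall₂_congr fun y hy => ?_
  by_cases hxy : x = y
  · simp [hxy]
  · simp [hxy, dodecExcess_eq_zero_iff (inner_ne_one_of_ne (hs x hx) (hs y hy) hxy)]

theorem excessSum_dodecConfig : excessSum dodecConfig = 0 := by
  rw [excessSum_eq_zero_iff _ onSphere_dodecConfig, dodecConfig_eq_image]
  intro x hx y hy hxy
  obtain ⟨i, -, rfl⟩ := Finset.mem_image.mp hx
  obtain ⟨j, -, rfl⟩ := Finset.mem_image.mp hy
  exact inner_dodecVertex_of_ne i j fun h => hxy (congrArg _ h)

theorem energy_dodecV (C : Finset (EuclideanSpace ℝ (Fin 3))) (hC : C.card = 20)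
    (hs : onSphere C) :
    energy dodecV C = (momentGap C + excessSum C + 4480 / 3) / 2 := by
  have h : ∑ x ∈ C, ∑ y ∈ C, (if x = y then 0 else dodecV (dist x y)) =
      ∑ x ∈ C, ∑ y ∈ C, ((1 + inner ℝ x y) ^ 5 - (if x = y then 32 else 0)
        + if x = y then 0 else dodecExcess (inner ℝ x y)) := by
    refine Finset.sum_congr rfl fun x hx => Finset.sum_congr rfl fun y hy => ?_
    split_ifs with hxy
    · rw [← hxy, real_inner_self_eq_norm_sq, hs x hx]
      norm_num
    · have hd : 1 - dist x y ^ 2 / 2 = inner ℝ x y := by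
        rw [dist_eq_norm, norm_sub_sq_real, hs x hx, hs y hy]
        ring
      rw [dodecV, hd, dodecW, dodecExcess, sub_zero]
  have h32 : ∑ x ∈ C, ∑ y ∈ C, (if x = y then (32 : ℝ) else 0) = 640 := by
    rw [Finset.sum_congr rfl fun x hx => (Finset.sum_ite_eq C x fun _ => (32 : ℝ)).trans
      (if_pos hx), Finset.sum_const, hC]
    norm_num
  have h5 := sum_sum_eq_momentGap_add C hC hs
  simp only [Finset.sum_add_distrib, Finset.sum_sub_distrib, h32, h5] at h
  rw [energy, h, excessSum]
  ring
theorem sum_inner_pow_mul_inner_eq {C : Finset (EuclideanSpace ℝ (Fin 3))}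
    (hgap : momentGap C = 0) {k : ℕ} (hk : k ≤ 4) (x v : EuclideanSpace ℝ (Fin 3)) :
    ∑ z ∈ C, (inner ℝ z x) ^ k * inner ℝ z v
      = ∑ z ∈ dodecConfig, (inner ℝ z x) ^ k * inner ℝ z v := by
  have hw : ∀ w, ∑ z ∈ C, tensorCoord z w = ∑ z ∈ dodecConfig, tensorCoord z w := by
    intro w
    have h := (Finset.sum_eq_zero_iff_of_nonneg fun _ _ => sq_nonneg _).mp hgap w
      (Finset.mem_univ w)
    exact sub_eq_zero.mp (pow_eq_zero_iff two_ne_zero |>.mp h)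
  have hprod : ∀ (α : Fin 5 → ℝ) (y : Fin 5 → EuclideanSpace ℝ (Fin 3)),
      ∑ z ∈ C, ∏ m, (α m + inner ℝ z (y m))
        = ∑ z ∈ dodecConfig, ∏ m, (α m + inner ℝ z (y m)) := by
    intro α y
    simp only [prod_add_inner_eq_sum]
    rw [Finset.sum_comm, Finset.sum_comm (s := dodecConfig)]
    simp only [← Finset.sum_mul, hw]
  have h := hprod (fun m => if m.val ≤ k then 0 else 1)
    (fun m => if m.val < k then x else if m.val = k then v else 0)
  interval_cases k <;> simpa [Fin.prod_univ_five, pow_succ] using h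

theorem sum_quartic_mul_inner {C : Finset (EuclideanSpace ℝ (Fin 3))} (hgap : momentGap C = 0)
    {x : EuclideanSpace ℝ (Fin 3)} (hx : ‖x‖ = 1) (v : EuclideanSpace ℝ (Fin 3))
    (a₀ a₁ a₂ a₃ a₄ : ℝ) :
    ∑ z ∈ C, (a₀ + a₁ * inner ℝ z x + a₂ * (inner ℝ z x) ^ 2 + a₃ * (inner ℝ z x) ^ 3
      + a₄ * (inner ℝ z x) ^ 4) * inner ℝ z v = (20 / 3 * a₁ + 4 * a₃) * inner ℝ x v := by
  have h0 := sum_inner_pow_mul_inner_eq hgap (k := 0) (by norm_num) x v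
  have h1 := sum_inner_pow_mul_inner_eq hgap (k := 1) (by norm_num) x v
  have h2 := sum_inner_pow_mul_inner_eq hgap (k := 2) (by norm_num) x v
  have h3 := sum_inner_pow_mul_inner_eq hgap (k := 3) (by norm_num) x v
  have h4 := sum_inner_pow_mul_inner_eq hgap (k := 4) (by norm_num) x v
  simp only [pow_zero, one_mul, pow_one, sum_dodecConfig_pow_zero, sum_dodecConfig_pow_one,
    sum_dodecConfig_pow_two, sum_dodecConfig_pow_three, sum_dodecConfig_pow_four, hx] at h0 h1 h2 h3 h4
  simp only [add_mul, mul_assoc, Finset.sum_add_distrib, ← Finset.mul_sum, h0, h1, h2, h3, h4]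
  ring

theorem sqrt_five_sq : Real.sqrt 5 ^ 2 = 5 := Real.sq_sqrt (by norm_num)

theorem sqrt_five_pos : 0 < Real.sqrt 5 := Real.sqrt_pos.mpr (by norm_num)

theorem sqrt_five_div_three_ne : Real.sqrt 5 / 3 ≠ -1 ∧ Real.sqrt 5 / 3 ≠ 1 / 3 ∧
    Real.sqrt 5 / 3 ≠ -1 / 3 ∧ Real.sqrt 5 / 3 ≠ -Real.sqrt 5 / 3 ∧ Real.sqrt 5 / 3 ≠ 1 := by
  have h := sqrt_five_sq
  have h0 := sqrt_five_pos
  refine ⟨?_, ?_, ?_, ?_, ?_⟩ <;> intro h' <;> nlinarith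

section Uniqueness

variable {C : Finset (EuclideanSpace ℝ (Fin 3))}

theorem card_neighbors (hC : C.card = 20) (hs : onSphere C) (hgap : momentGap C = 0)
    (hin : ∀ x ∈ C, ∀ y ∈ C, x ≠ y → IsDodecInner (inner ℝ x y))
    {x : EuclideanSpace ℝ (Fin 3)} (hx : x ∈ C) :
    (C.filter fun z => inner ℝ z x = Real.sqrt 5 / 3).card = 3 := by
  have hsum := sum_quartic_mul_inner hgap (hs x hx) x (1 / 9) (-10 * Real.sqrt 5 / 27) (-10 / 9)
    (Real.sqrt 5 / 3) 1
  rw [real_inner_self_eq_norm_sq, hs x hx] at hsum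
  have hterm : ∀ z ∈ C, (1 / 9 + -10 * Real.sqrt 5 / 27 * inner ℝ z x
      + -10 / 9 * (inner ℝ z x) ^ 2 + Real.sqrt 5 / 3 * (inner ℝ z x) ^ 3
      + 1 * (inner ℝ z x) ^ 4) * inner ℝ z x =
      (if inner ℝ z x = Real.sqrt 5 / 3 then -32 / 243 * Real.sqrt 5 else 0)
        - Real.sqrt 5 / 27 := by
    intro z hz
    have h5 := sqrt_five_sq
    obtain ⟨n1, n2, n3, n4, n5⟩ := sqrt_five_div_three_ne
    by_cases hzx : z = x
    · rw [hzx, real_inner_self_eq_norm_sq, hs x hx, one_pow, if_neg n5.symm]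
      ring
    rcases hin z hz x hx hzx with h | h | h | h | h <;> rw [h]
    · rw [if_neg n1.symm]
      ring
    · rw [if_neg n2.symm]
      ring
    · rw [if_neg n3.symm]
      ring
    · rw [if_pos rfl]
      linear_combination (Real.sqrt 5 ^ 3 * 2 / 243 - Real.sqrt 5 * 10 / 243) * h5
    · rw [if_neg n4.symm]
      ring
  rw [Finset.sum_congr rfl hterm, Finset.sum_sub_distrib, ← Finset.sum_filter, Finset.sum_const,
    Finset.sum_const, hC, nsmul_eq_mul, nsmul_eq_mul] at hsum
  have h3 : ((C.filter fun z => inner ℝ z x = Real.sqrt 5 / 3).card : ℝ) = 3 := by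
    have h0 := sqrt_five_pos.ne'
    apply mul_right_cancel₀ h0
    push_cast at hsum
    linear_combination -243 / 32 * hsum
  exact_mod_cast h3

theorem sum_neighbors_inner (hs : onSphere C) (hgap : momentGap C = 0)
    (hin : ∀ x ∈ C, ∀ y ∈ C, x ≠ y → IsDodecInner (inner ℝ x y))
    {x : EuclideanSpace ℝ (Fin 3)} (hx : x ∈ C) (v : EuclideanSpace ℝ (Fin 3)) :
    ∑ z ∈ C.filter fun z => inner ℝ z x = Real.sqrt 5 / 3, inner ℝ z v
      = Real.sqrt 5 * inner ℝ x v := by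
  have hsum := sum_quartic_mul_inner hgap (hs x hx) v (-Real.sqrt 5 / 27)
    (-(1 + Real.sqrt 5 / 3) / 9) (Real.sqrt 5 / 3 - 1 / 9) (1 + Real.sqrt 5 / 3) 1
  have h5 := sqrt_five_sq
  have hterm : ∀ z ∈ C, (-Real.sqrt 5 / 27 + -(1 + Real.sqrt 5 / 3) / 9 * inner ℝ z x
      + (Real.sqrt 5 / 3 - 1 / 9) * (inner ℝ z x) ^ 2 + (1 + Real.sqrt 5 / 3) * (inner ℝ z x) ^ 3
      + 1 * (inner ℝ z x) ^ 4) * inner ℝ z v =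
      (if z = x then 16 / 9 * (1 + Real.sqrt 5 / 3) * inner ℝ x v else 0)
      + 8 / 27 * Real.sqrt 5 * (1 + Real.sqrt 5 / 3) *
        (if inner ℝ z x = Real.sqrt 5 / 3 then inner ℝ z v else 0) := by
    intro z hz
    obtain ⟨n1, n2, n3, n4, n5⟩ := sqrt_five_div_three_ne
    by_cases hzx : z = x
    · rw [hzx, real_inner_self_eq_norm_sq, hs x hx, one_pow, if_neg n5.symm, if_pos rfl]
      ring
    rw [if_neg hzx]
    rcases hin z hz x hx hzx with h | h | h | h | h <;> rw [h]
    · rw [if_neg n1.symm]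
      ring
    · rw [if_neg n2.symm]
      ring
    · rw [if_neg n3.symm]
      ring
    · rw [if_pos rfl]
      linear_combination
        (2 / 27 * Real.sqrt 5 + 2 / 81 * Real.sqrt 5 ^ 2) * inner ℝ z v * h5
    · rw [if_neg n4.symm]
      ring
  rw [Finset.sum_congr rfl hterm, Finset.sum_add_distrib, ← Finset.mul_sum,
    Finset.sum_ite_eq' C x, if_pos hx, ← Finset.sum_filter] at hsum
  have hne : 8 / 27 * Real.sqrt 5 * (1 + Real.sqrt 5 / 3) ≠ 0 := by
    have := sqrt_five_pos
    positivity
  apply mul_left_cancel₀ hne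
  linear_combination hsum - 8 / 27 * (1 + Real.sqrt 5 / 3) * inner ℝ x v * h5

theorem exists_neighbors (hC : C.card = 20) (hs : onSphere C) (hgap : momentGap C = 0)
    (hin : ∀ x ∈ C, ∀ y ∈ C, x ≠ y → IsDodecInner (inner ℝ x y)) :
    ∃ x ∈ C, ∃ n : Fin 3 → EuclideanSpace ℝ (Fin 3), (∀ k, n k ∈ C) ∧
      (∀ k l, inner ℝ (n k) (n l) = if k = l then (1 : ℝ) else 1 / 3) ∧
      ∀ v, inner ℝ (n 0) v + inner ℝ (n 1) v + inner ℝ (n 2) v = Real.sqrt 5 * inner ℝ x v := by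
  obtain ⟨x, hx⟩ : C.Nonempty := Finset.card_pos.mp (by omega)
  have hsum := sum_neighbors_inner hs hgap hin hx
  obtain ⟨a, b, c, hab, hac, hbc, habc⟩ :=
    Finset.card_eq_three.mp (card_neighbors hC hs hgap hin hx)
  have hmem : ∀ z ∈ ({a, b, c} : Finset (EuclideanSpace ℝ (Fin 3))),
      z ∈ C ∧ inner ℝ z x = Real.sqrt 5 / 3 := by
    rw [← habc]
    exact fun z hz => Finset.mem_filter.mp hz
  obtain ⟨ha, ha'⟩ := hmem a (by simp)
  obtain ⟨hb, hb'⟩ := hmem b (by simp)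
  obtain ⟨hc, hc'⟩ := hmem c (by simp)
  simp only [habc, Finset.sum_insert (show a ∉ {b, c} by simp [hab, hac]),
    Finset.sum_insert (show b ∉ {c} by simp [hbc]), Finset.sum_singleton] at hsum
  have haa : inner ℝ a a = (1 : ℝ) := by rw [real_inner_self_eq_norm_sq, hs a ha, one_pow]
  have hbb : inner ℝ b b = (1 : ℝ) := by rw [real_inner_self_eq_norm_sq, hs b hb, one_pow]
  have hcc : inner ℝ c c = (1 : ℝ) := by rw [real_inner_self_eq_norm_sq, hs c hc, one_pow]
  have h5 := sqrt_five_sq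
  have h1 := hsum a
  have h2 := hsum b
  have h3 := hsum c
  rw [real_inner_comm a x, ha', haa, real_inner_comm a b, real_inner_comm a c] at h1
  rw [real_inner_comm b x, hb', hbb, real_inner_comm b c] at h2
  rw [real_inner_comm c x, hc', hcc] at h3
  have hab' : inner ℝ a b = (1 / 3 : ℝ) := by
    linear_combination (h1 + h2 - h3 + 1 / 3 * h5) / 2
  have hac' : inner ℝ a c = (1 / 3 : ℝ) := by
    linear_combination (h1 - h2 + h3 + 1 / 3 * h5) / 2
  have hbc' : inner ℝ b c = (1 / 3 : ℝ) := by
    linear_combination (h2 + h3 - h1 + 1 / 3 * h5) / 2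
  refine ⟨x, hx, ![a, b, c], ?_, ?_, fun v => ?_⟩
  · intro k
    fin_cases k
    exacts [ha, hb, hc]
  · intro k l
    fin_cases k <;> fin_cases l <;>
      simp [hs a ha, hs b hb, hs c hc, hab', hac', hbc', real_inner_comm a b, real_inner_comm a c,
        real_inner_comm b c]
  · simpa [add_assoc] using hsum v
/-- The coordinates of the cube frame in terms of three neighbours of a cube vertex. -/
noncomputable def frameCoeff (j k : Fin 3) : ℝ :=
  (Real.sqrt 3)⁻¹ * (3 / 2) *
    (goldenEval (dodecCoord (.inr (k, true, true)) j) - (2 * phi - 1) / 5)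

theorem frameCoeff_eq (j k : Fin 3) :
    frameCoeff j k = (Real.sqrt 3)⁻¹ * (3 / 2) *
      ((![![0, phi, phi - 1], ![phi - 1, 0, phi], ![phi, phi - 1, 0]] : Fin 3 → Fin 3 → ℝ) j k
        - (2 * phi - 1) / 5) := by
  unfold frameCoeff
  congr 2
  fin_cases k <;> fin_cases j <;>
    simp [dodecCoord, boolSign, goldenEval_phi, goldenEval_phi_inv, phi_inv]

theorem inner_sum_smul_sum_smul {n : Fin 3 → EuclideanSpace ℝ (Fin 3)}
    (hn : ∀ k l, inner ℝ (n k) (n l) = if k = l then (1 : ℝ) else 1 / 3) (a b : Fin 3 → ℝ) :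
    inner ℝ (∑ k, a k • n k) (∑ k, b k • n k)
      = 2 / 3 * (a 0 * b 0 + a 1 * b 1 + a 2 * b 2)
        + 1 / 3 * ((a 0 + a 1 + a 2) * (b 0 + b 1 + b 2)) := by
  simp only [Fin.sum_univ_three, inner_add_left, inner_add_right, inner_smul_left,
    inner_smul_right, hn]
  simp
  ring

theorem orthonormal_frame {n : Fin 3 → EuclideanSpace ℝ (Fin 3)}
    (hn : ∀ k l, inner ℝ (n k) (n l) = if k = l then (1 : ℝ) else 1 / 3) :
    Orthonormal ℝ fun j => ∑ k, frameCoeff j k • n k := by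
  rw [orthonormal_iff_ite]
  intro i j
  rw [inner_sum_smul_sum_smul hn]
  have h3 := inv_sqrt_three_sq
  have hφ := phi_sq
  simp only [frameCoeff_eq]
  have hdiag : ∀ A : ℝ, A = (Real.sqrt 3)⁻¹ ^ 2 * (3 + 9 / 5 * (phi ^ 2 - phi - 1)) → A = 1 := by
    intro A h
    linear_combination h + 3 * h3 + 9 / 5 * (Real.sqrt 3)⁻¹ ^ 2 * hφ
  have hoff : ∀ A : ℝ, A = (Real.sqrt 3)⁻¹ ^ 2 * (3 / 10 * (phi ^ 2 - phi - 1)) → A = 0 := by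
    intro A h
    linear_combination h + 3 / 10 * (Real.sqrt 3)⁻¹ ^ 2 * hφ
  by_cases hij : i = j
  · rw [if_pos hij, ← hij]
    apply hdiag
    fin_cases i <;> simp only [Fin.zero_eta, Fin.mk_one, Fin.reduceFinMk, Matrix.cons_val] <;> ring
  · rw [if_neg hij]
    apply hoff
    fin_cases i <;> fin_cases j <;> first | exact absurd rfl hij | skip
    all_goals
      simp only [Fin.zero_eta, Fin.mk_one, Fin.reduceFinMk, Matrix.cons_val]
      ring

/-- The orthonormal basis in which three given neighbours of a cube vertex have the coordinates
of the corresponding vertices of the standard dodecahedron. -/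
noncomputable def frameBasis {n : Fin 3 → EuclideanSpace ℝ (Fin 3)}
    (hn : ∀ k l, inner ℝ (n k) (n l) = if k = l then (1 : ℝ) else 1 / 3) :
    OrthonormalBasis (Fin 3) ℝ (EuclideanSpace ℝ (Fin 3)) :=
  OrthonormalBasis.mk (orthonormal_frame hn)
    ((orthonormal_frame hn).linearIndependent.span_eq_top_of_card_eq_finrank' (by simp)).ge

theorem inner_frameBasis {n : Fin 3 → EuclideanSpace ℝ (Fin 3)}
    (hn : ∀ k l, inner ℝ (n k) (n l) = if k = l then (1 : ℝ) else 1 / 3) (j : Fin 3)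
    (z : EuclideanSpace ℝ (Fin 3)) :
    inner ℝ (frameBasis hn j) z = frameCoeff j 0 * inner ℝ z (n 0)
      + frameCoeff j 1 * inner ℝ z (n 1) + frameCoeff j 2 * inner ℝ z (n 2) := by
  rw [frameBasis, OrthonormalBasis.coe_mk, Fin.sum_univ_three, real_inner_comm]
  simp only [inner_add_right, real_inner_smul_right]

theorem norm_sq_eq_of_neighbors {n : Fin 3 → EuclideanSpace ℝ (Fin 3)}
    (hn : ∀ k l, inner ℝ (n k) (n l) = if k = l then (1 : ℝ) else 1 / 3)
    (z : EuclideanSpace ℝ (Fin 3)) :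
    ‖z‖ ^ 2 = 3 / 2 * ((inner ℝ z (n 0)) ^ 2 + (inner ℝ z (n 1)) ^ 2 + (inner ℝ z (n 2)) ^ 2)
      - 3 / 10 * (inner ℝ z (n 0) + inner ℝ z (n 1) + inner ℝ z (n 2)) ^ 2 := by
  have h := (frameBasis hn).sum_sq_norm_inner_right z
  simp only [Fin.sum_univ_three, inner_frameBasis, Real.norm_eq_abs, sq_abs, frameCoeff_eq] at h
  rw [← h]
  simp only [Matrix.cons_val]
  generalize inner ℝ z (n 0) = a
  generalize inner ℝ z (n 1) = b
  generalize inner ℝ z (n 2) = c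
  linear_combination (9 / 2 * (a ^ 2 + b ^ 2 + c ^ 2) - 9 / 10 * (a + b + c) ^ 2)
      * inv_sqrt_three_sq
    + 9 / 4 * (Real.sqrt 3)⁻¹ ^ 2 * (22 / 25 * (a ^ 2 + b ^ 2 + c ^ 2)
      - 6 / 25 * (a * b + a * c + b * c)) * phi_sq

theorem frame_reconstruct (X : Fin 3 → ℝ) (j : Fin 3) :
    let d : Fin 3 → ℝ := fun k =>
      (X 0 * goldenEval (dodecCoord (.inr (k, true, true)) 0)
        + X 1 * goldenEval (dodecCoord (.inr (k, true, true)) 1)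
        + X 2 * goldenEval (dodecCoord (.inr (k, true, true)) 2)) / 3
    frameCoeff j 0 * d 0 + frameCoeff j 1 * d 1 + frameCoeff j 2 * d 2
      = (Real.sqrt 3)⁻¹ * X j := by
  intro d
  have hd : d 0 = (X 1 * (phi - 1) + X 2 * phi) / 3 ∧ d 1 = (X 0 * phi + X 2 * (phi - 1)) / 3 ∧
      d 2 = (X 0 * (phi - 1) + X 1 * phi) / 3 := by
    simp [d, dodecCoord, boolSign, goldenEval_phi, goldenEval_phi_inv, phi_inv]
  rw [hd.1, hd.2.1, hd.2.2]
  have hX : X j * (phi ^ 2 - phi - 1) = 0 := by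
    linear_combination X j * phi_sq
  simp only [frameCoeff_eq]
  fin_cases j <;> simp only [Fin.zero_eta, Fin.mk_one, Fin.reduceFinMk, Matrix.cons_val] at hX ⊢ <;>
    linear_combination (Real.sqrt 3)⁻¹ / 2 * hX
      + (Real.sqrt 3)⁻¹ / 10 * (X 0 + X 1 + X 2) * phi_sq

theorem isOrthImage_dodecConfig (hC : C.card = 20) (hs : onSphere C) (hgap : momentGap C = 0)
    (hin : ∀ x ∈ C, ∀ y ∈ C, x ≠ y → IsDodecInner (inner ℝ x y)) :
    isOrthImage dodecConfig C := by
  obtain ⟨x, hx, n, hnC, hn, hsum⟩ := exists_neighbors hC hs hgap hin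
  have hval : ∀ z ∈ C, ∀ y ∈ C, ∃ o : Option (Fin 5),
      inner ℝ z y = goldenEval (o.elim 3 dodecInner) / 3 := by
    intro z hz y hy
    by_cases h : z = y
    · refine ⟨none, ?_⟩
      rw [h, real_inner_self_eq_norm_sq, hs y hy, Option.elim_none, map_ofNat]
      norm_num
    · obtain ⟨k, hk⟩ := (isDodecInner_iff _).mp (hin z hz y hy h)
      exact ⟨some k, hk⟩
  refine ⟨(frameBasis hn).repr.symm, Finset.eq_of_subset_of_card_le ?_ ?_⟩
  · intro z hz
    choose o ho using fun k => hval z hz (n k) (hnC k)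
    obtain ⟨o', ho'⟩ := hval z hz x hx
    have hσ := hsum z
    rw [real_inner_comm z, real_inner_comm z, real_inner_comm z, real_inner_comm z, ho', ho, ho,
      ho, sqrt_five_eq] at hσ
    have hnorm := norm_sq_eq_of_neighbors hn z
    rw [hs z hz, ho, ho, ho] at hnorm
    obtain ⟨i, hi⟩ := exists_dodecCoord_of_inner ![o 0, o 1, o 2, o']
      (goldenEval_injective (by
        simp only [map_add, map_mul]
        rw [show goldenEval ⟨-1, 2⟩ = 2 * phi - 1 by
          rw [goldenEval_apply]
          push_cast
          ring]
        simp
        linear_combination 3 * hσ))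
      (goldenEval_injective (by
        simp only [map_add, map_mul, map_ofNat]
        simp
        generalize goldenEval ((o 0).elim 3 dodecInner) = a at hσ hnorm ⊢
        generalize goldenEval ((o 1).elim 3 dodecInner) = b at hσ hnorm ⊢
        generalize goldenEval ((o 2).elim 3 dodecInner) = c at hσ hnorm ⊢
        generalize goldenEval (o'.elim 3 dodecInner) = σ at hσ hnorm ⊢
        linear_combination -6 * hnorm + 3 / 5 * (a + b + c + (2 * phi - 1) * σ) * hσ
          + 4 / 5 * σ ^ 2 * phi_sq))
    refine Finset.mem_image.mpr ⟨dodecVertex i, ?_, ?_⟩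
    · rw [dodecConfig_eq_image]
      exact Finset.mem_image_of_mem _ (Finset.mem_univ i)
    · rw [LinearIsometryEquiv.symm_apply_eq]
      ext j
      rw [OrthonormalBasis.repr_apply_apply, inner_frameBasis, ho, ho, ho]
      have h0 := hi 0
      have h1 := hi 1
      have h2 := hi 2
      simp at h0 h1 h2
      rw [← h0, ← h1, ← h2]
      simp only [goldenDot, map_add, map_mul]
      exact (frame_reconstruct (fun l => goldenEval (dodecCoord i l)) j).symm
  · rw [hC, ← card_dodecConfig]
    exact Finset.card_image_le

end Uniqueness

/-- Theorem 3: the regular dodecahedron is the unique global energy minimizer of `dodecV`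
among 20-point configurations on `S²`. -/
theorem dodecahedron_unique_ground_state :
    ∀ C : Finset (EuclideanSpace ℝ (Fin 3)), C.card = 20 → onSphere C →
      energy dodecV dodecConfig ≤ energy dodecV C ∧
      (energy dodecV C = energy dodecV dodecConfig → isOrthImage dodecConfig C) := by
  intro C hC hs
  rw [energy_dodecV C hC hs, energy_dodecV _ card_dodecConfig onSphere_dodecConfig,
    momentGap_dodecConfig, excessSum_dodecConfig]
  have hm := momentGap_nonneg C
  have he := excessSum_nonneg C
  refine ⟨by linarith, fun h => isOrthImage_dodecConfig hC hs (by linarith) ?_⟩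
  exact (excessSum_eq_zero_iff C hs).mp (by linarith)
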